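/- (Delsarte) Let C be a nonempty (n,d,w) constant-weight code with d even and d < 2w ≤ n, and let {A_{2i}}_{i=d/2}^{w} be its distance distribution. Then for every k = 1, 2, …, w, one has Σ_{i=d/2}^{w} q(k,i,n,w) · A_{2i} ≥ −1, where q(k,i,n,w) = [ Σ_{j=0}^{i} (−1)^j · C(k,j) · C(w−k, i−j) · C(n−w−k, i−j) ] / [ C(w,i) · C(n−w,i) ]. -/

import Mathlib

/-- The number of ones of a binary vector. -/
def wtOnes {n : ℕ} (u : Fin n → ZMod 2) : ℕ :=
  (Finset.univ.filter (fun t => u t = 1)).card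

/-- `C` is an `(n,d,w)` constant-weight binary code. -/
def IsCWCode (n d w : ℕ) (C : Finset (Fin n → ZMod 2)) : Prop :=
  (∀ c ∈ C, wtOnes c = w) ∧
  ∀ u ∈ C, ∀ v ∈ C, u ≠ v → d ≤ hammingDist u v

/-- `A n d w`: the largest possible size of an `(n,d,w)` constant-weight code. -/
noncomputable def A (n d w : ℕ) : ℕ :=
  sSup {M | ∃ C : Finset (Fin n → ZMod 2), IsCWCode n d w C ∧ C.card = M}

/-- `C` is a `(w1,n1,w2,n2,d)` doubly-constant-weight binary code. -/
def IsDCWCode (w1 n1 w2 n2 d : ℕ) (C : Finset (Fin n1 ⊕ Fin n2 → ZMod 2)) : Prop :=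
  (∀ c ∈ C,
    (Finset.univ.filter (fun t : Fin n1 => c (Sum.inl t) = 1)).card = w1 ∧
    (Finset.univ.filter (fun t : Fin n2 => c (Sum.inr t) = 1)).card = w2) ∧
  ∀ u ∈ C, ∀ v ∈ C, u ≠ v → d ≤ hammingDist u v

/-- `T w1 n1 w2 n2 d`: the largest possible size of a `(w1,n1,w2,n2,d)`
doubly-constant-weight code. -/
noncomputable def T (w1 n1 w2 n2 d : ℕ) : ℕ :=
  sSup {M | ∃ C : Finset (Fin n1 ⊕ Fin n2 → ZMod 2), IsDCWCode w1 n1 w2 n2 d C ∧ C.card = M}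

/-- `S_i(c)`: the set of codewords of `C` at distance `i` from `c`. -/
def Sdist {n : ℕ} (C : Finset (Fin n → ZMod 2)) (c : Fin n → ZMod 2) (i : ℕ) :
    Finset (Fin n → ZMod 2) :=
  C.filter (fun u => hammingDist u c = i)

/-- The distance distribution `A_i = (1/|C|) ∑_{c ∈ C} |S_i(c)|` of a code `C`. -/
noncomputable def distDistr {n : ℕ} (C : Finset (Fin n → ZMod 2)) (i : ℕ) : ℚ :=
  (∑ c ∈ C, ((Sdist C c i).card : ℚ)) / (C.card : ℚ)

/-- `V_i`: vectors of `F^n` with exactly `i` ones on the first `w` coordinates and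
exactly `i` ones on the last `n - w` coordinates. -/
def Vset (n w i : ℕ) : Finset (Fin n → ZMod 2) :=
  Finset.univ.filter (fun u =>
    (Finset.univ.filter (fun t : Fin n => t.val < w ∧ u t = 1)).card = i ∧
    (Finset.univ.filter (fun t : Fin n => w ≤ t.val ∧ u t = 1)).card = i)

/-- `m_{i,j} = max { d(u,v) : u ∈ V_i, v ∈ V_j }`. -/
def mMax (n w i j : ℕ) : ℕ :=
  ((Vset n w i) ×ˢ (Vset n w j)).sup fun p => hammingDist p.1 p.2

/-- `P⁻_k(n;x) = ∑_{j odd} C(x,j) C(n-x,k-j)`. -/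
def Pminus (k n x : ℕ) : ℕ :=
  ∑ j ∈ Finset.range (k + 1), if Odd j then x.choose j * (n - x).choose (k - j) else 0

/-- `P⁺_k(n;x) = ∑_{j even} C(x,j) C(n-x,k-j)`. -/
def Pplus (k n x : ℕ) : ℕ :=
  ∑ j ∈ Finset.range (k + 1), if Even j then x.choose j * (n - x).choose (k - j) else 0

/-- The Krawtchouk polynomial `P_k(n;x) = ∑_j (-1)^j C(x,j) C(n-x,k-j)` at integer points. -/
def Kraw (k n x : ℕ) : ℤ :=
  ∑ j ∈ Finset.range (k + 1), (-1 : ℤ) ^ j * x.choose j * (n - x).choose (k - j)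

open Finset in
/-- The kernel `∑_{i+j=k} (-1)^i C(k,i) (p)_j (r)_j (s)_i (t)_i` in falling factorials; here `p`,
`r`, `s`, `t` stand for the sizes of `S ∩ T`, of the complement of `S ∪ T`, of `S \ T` and of
`T \ S`. -/
def pairKernel (k p r s t : ℕ) : ℚ :=
  ∑ ij ∈ antidiagonal k, (k.choose ij.1 : ℚ) * ((-1 : ℚ) ^ ij.1 * p.descFactorial ij.2 *
    r.descFactorial ij.2 * s.descFactorial ij.1 * t.descFactorial ij.1)

theorem descFactorial_succ_eq_mul_pred (p k : ℕ) :
    p.descFactorial (k + 1) = p * (p - 1).descFactorial k := by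
  cases p with
  | zero => simp
  | succ p => rw [Nat.succ_descFactorial_succ, Nat.add_sub_cancel]

theorem pairKernel_succ (k p r s t : ℕ) :
    pairKernel (k + 1) p r s t =
      p * r * pairKernel k (p - 1) (r - 1) s t - s * t * pairKernel k p r (s - 1) (t - 1) := by
  unfold pairKernel
  rw [Finset.sum_antidiagonal_choose_succ_mul
    (fun i j => (-1 : ℚ) ^ i * p.descFactorial j *
      r.descFactorial j * s.descFactorial i * t.descFactorial i), Finset.mul_sum, Finset.mul_sum,
    sub_eq_add_neg, ← Finset.sum_neg_distrib]
  congr 1 <;> refine Finset.sum_congr rfl fun ij hij => ?_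
  · simp only [descFactorial_succ_eq_mul_pred]
    push_cast
    ring
  · rw [Nat.choose_symm_of_eq_add (Finset.HasAntidiagonal.mem_antidiagonal.mp hij).symm]
    simp only [descFactorial_succ_eq_mul_pred]
    push_cast
    ring

section Kernel

variable {α : Type*} [DecidableEq α]

/-- The indicator of `S` at `a`, minus the indicator of `S` at `b`. -/
def indDiff (S : Finset α) (a b : α) : ℚ :=
  (if a ∈ S then 1 else 0) - (if b ∈ S then 1 else 0)

/-- The sum of `∏ i, indDiff S (a i) (b i) * indDiff T (a i) (b i)` over all choices of `k` disjoint
ordered pairs `(a i, b i)` of elements of `U`. -/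
def pairSum : ℕ → Finset α → Finset α → Finset α → ℚ
  | 0, _, _, _ => 1
  | k + 1, U, S, T =>
      ∑ a ∈ U, ∑ b ∈ U, indDiff S a b * indDiff T a b * pairSum k ((U.erase a).erase b) S T

theorem pairSum_posSemidef {ι : Type*} (s : ι → Finset α) (C : Finset ι) (k : ℕ) :
    ∀ (U : Finset α) (c : ι → ℚ),
      0 ≤ ∑ u ∈ C, ∑ v ∈ C, c u * c v * pairSum k U (s u) (s v) := by
  induction k with
  | zero =>
    intro U c
    simp only [pairSum, mul_one, ← Finset.sum_mul_sum]
    exact mul_self_nonneg _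
  | succ k ih =>
    intro U c
    have key : ∑ u ∈ C, ∑ v ∈ C, c u * c v * pairSum (k + 1) U (s u) (s v) =
        ∑ a ∈ U, ∑ b ∈ U, ∑ u ∈ C, ∑ v ∈ C,
          (c u * indDiff (s u) a b) * (c v * indDiff (s v) a b) *
            pairSum k ((U.erase a).erase b) (s u) (s v) := by
      simp only [pairSum, Finset.mul_sum]
      rw [Finset.sum_congr rfl fun u _ => Finset.sum_comm, Finset.sum_comm]
      refine Finset.sum_congr rfl fun a _ => ?_
      rw [Finset.sum_congr rfl fun u _ => Finset.sum_comm, Finset.sum_comm]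
      refine Finset.sum_congr rfl fun b _ => Finset.sum_congr rfl fun u _ =>
        Finset.sum_congr rfl fun v _ => by ring
    rw [key]
    exact Finset.sum_nonneg fun a _ => Finset.sum_nonneg fun b _ => ih _ _

theorem pairSum_eq (S T : Finset α) (k : ℕ) : ∀ U : Finset α,
    pairSum k U S T = 2 ^ k * pairKernel k (U.filter fun x => x ∈ S ∧ x ∈ T).card
      (U.filter fun x => x ∉ S ∧ x ∉ T).card (U.filter fun x => x ∈ S ∧ x ∉ T).card
      (U.filter fun x => x ∉ S ∧ x ∈ T).card := by
  induction k with
  | zero => intro U; simp [pairSum, pairKernel]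
  | succ k ih =>
    intro U
    rw [pairKernel_succ]
    simp only [pairSum, ih]
    set p := (U.filter fun x => x ∈ S ∧ x ∈ T).card with hp
    set r := (U.filter fun x => x ∉ S ∧ x ∉ T).card with hr
    set s := (U.filter fun x => x ∈ S ∧ x ∉ T).card with hs
    set t := (U.filter fun x => x ∉ S ∧ x ∈ T).card with ht
    have term : ∀ a ∈ U, ∀ b ∈ U, indDiff S a b * indDiff T a b *
        (2 ^ k * pairKernel k
          (((U.erase a).erase b).filter fun x => x ∈ S ∧ x ∈ T).card
          (((U.erase a).erase b).filter fun x => x ∉ S ∧ x ∉ T).card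
          (((U.erase a).erase b).filter fun x => x ∈ S ∧ x ∉ T).card
          (((U.erase a).erase b).filter fun x => x ∉ S ∧ x ∈ T).card) =
        ((if a ∈ S ∧ a ∈ T then 1 else 0) * (if b ∉ S ∧ b ∉ T then 1 else 0) +
          (if a ∉ S ∧ a ∉ T then 1 else 0) * (if b ∈ S ∧ b ∈ T then 1 else 0)) *
            (2 ^ k * pairKernel k (p - 1) (r - 1) s t) -
        ((if a ∈ S ∧ a ∉ T then 1 else 0) * (if b ∉ S ∧ b ∈ T then 1 else 0) +
          (if a ∉ S ∧ a ∈ T then 1 else 0) * (if b ∈ S ∧ b ∉ T then 1 else 0)) *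
            (2 ^ k * pairKernel k p r (s - 1) (t - 1)) := by
      intro a ha b hb
      simp only [Finset.filter_erase, Finset.card_erase_eq_ite, Finset.mem_erase,
        Finset.mem_filter, ha, hb, true_and, ← hp, ← hr, ← hs, ← ht]
      by_cases haS : a ∈ S <;> by_cases haT : a ∈ T <;> by_cases hbS : b ∈ S <;>
        by_cases hbT : b ∈ T <;> simp [indDiff, haS, haT, hbS, hbT] <;>
        (have hne : b ≠ a := by rintro rfl; contradiction) <;> simp [hne]
    rw [Finset.sum_congr rfl fun a ha => Finset.sum_congr rfl fun b hb => term a ha b hb]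
    simp only [Finset.sum_sub_distrib, ← Finset.sum_mul, Finset.sum_add_distrib,
      ← Finset.sum_mul_sum, Finset.sum_boole, ← hp, ← hr, ← hs, ← ht]
    ring

end Kernel

theorem choose_sub_mul_descFactorial {w k i j : ℕ} (hkw : k ≤ w) (hjk : j ≤ k) (hiw : i ≤ w) :
    (w - k).choose (i - j) * w.descFactorial k * (if j ≤ i then 1 else 0) =
      w.choose i * ((w - i).descFactorial (k - j) * i.descFactorial j) := by
  split_ifs with hji
  swap
  · simp [Nat.descFactorial_eq_zero_iff_lt.mpr (not_le.mp hji)]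
  by_cases h : i - j ≤ w - k
  swap
  · rw [Nat.choose_eq_zero_of_lt (not_le.mp h),
      Nat.descFactorial_eq_zero_iff_lt.mpr (by omega : w - i < k - j)]
    simp
  have e1 := Nat.choose_mul_factorial_mul_factorial h
  have e2 := Nat.factorial_mul_descFactorial hkw
  have e3 := Nat.choose_mul_factorial_mul_factorial hiw
  have e4 := Nat.factorial_mul_descFactorial (by omega : k - j ≤ w - i)
  have e5 := Nat.factorial_mul_descFactorial hji
  rw [show w - k - (i - j) = w - i - (k - j) by omega] at e1
  have hpos : 0 < (i - j).factorial * (w - i - (k - j)).factorial := by positivity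
  apply Nat.eq_of_mul_eq_mul_right hpos
  calc _ = ((w - k).choose (i - j) * (i - j).factorial * (w - i - (k - j)).factorial) *
        w.descFactorial k := by ring
    _ = w.choose i * i.factorial * (w - i).factorial := by rw [e1, e2, e3]
    _ = _ := by rw [← e4, ← e5]; ring

/-- The normalised Johnson-scheme eigenvalue `q(k,i,n,w)`. -/
def johnsonQ (n w k i : ℕ) : ℚ :=
  (∑ j ∈ Finset.range (i + 1),
    (-1 : ℚ) ^ j * (k.choose j) * ((w - k).choose (i - j)) * ((n - w - k).choose (i - j))) /
      ((w.choose i : ℚ) * ((n - w).choose i : ℚ))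

theorem johnsonQ_zero (n w k : ℕ) : johnsonQ n w k 0 = 1 := by
  simp [johnsonQ]

theorem johnsonQ_mul_eq_pairKernel {n w k i : ℕ} (hwn : 2 * w ≤ n) (hkw : k ≤ w) (hiw : i ≤ w) :
    johnsonQ n w k i * (w.descFactorial k * (n - w).descFactorial k) =
      pairKernel k (w - i) (n - w - i) i i := by
  have h1 : (w.choose i : ℚ) ≠ 0 := by exact_mod_cast (Nat.choose_pos hiw).ne'
  have h2 : ((n - w).choose i : ℚ) ≠ 0 := by
    exact_mod_cast (Nat.choose_pos (by omega : i ≤ n - w)).ne'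
  have extend : ∑ j ∈ Finset.range (i + 1), (-1 : ℚ) ^ j * (k.choose j) *
        ((w - k).choose (i - j)) * ((n - w - k).choose (i - j)) =
      ∑ j ∈ Finset.range (k + 1), (if j ≤ i then (-1 : ℚ) ^ j * (k.choose j) *
        ((w - k).choose (i - j)) * ((n - w - k).choose (i - j)) else 0) := by
    rw [← Finset.sum_filter]
    refine (Finset.sum_subset ?_ ?_).symm
    · intro j hj
      simp only [Finset.mem_filter, Finset.mem_range] at hj ⊢
      omega
    · intro j hj hj'
      simp only [Finset.mem_filter, Finset.mem_range] at hj hj'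
      rw [Nat.choose_eq_zero_of_lt (by omega : k < j)]
      simp
  rw [johnsonQ, extend, div_mul_eq_mul_div, div_eq_iff (mul_ne_zero h1 h2), pairKernel,
    Finset.Nat.sum_antidiagonal_eq_sum_range_succ_mk, Finset.sum_mul, Finset.sum_mul]
  refine Finset.sum_congr rfl fun j hj => ?_
  have hjk : j ≤ k := by simpa [Nat.lt_succ_iff] using hj
  have e1 := congrArg (Nat.cast (R := ℚ)) (choose_sub_mul_descFactorial hkw hjk hiw)
  have e2 := congrArg (Nat.cast (R := ℚ))
    (choose_sub_mul_descFactorial (by omega : k ≤ n - w) hjk (by omega : i ≤ n - w))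
  push_cast at e1 e2
  calc _ = (-1 : ℚ) ^ j * k.choose j *
        ((w - k).choose (i - j) * w.descFactorial k * (if j ≤ i then 1 else 0)) *
        ((n - w - k).choose (i - j) * (n - w).descFactorial k * (if j ≤ i then 1 else 0)) := by
        split_ifs <;> ring
    _ = _ := by rw [e1, e2]; ring

/-- The set of coordinates where a binary vector equals one. -/
def onesSet {n : ℕ} (u : Fin n → ZMod 2) : Finset (Fin n) :=
  Finset.univ.filter fun t => u t = 1

theorem hammingDist_eq_card_sdiff_add {n : ℕ} (u v : Fin n → ZMod 2) :
    hammingDist u v = (onesSet u \ onesSet v).card + (onesSet v \ onesSet u).card := by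
  rw [hammingDist, ← Finset.card_union_of_disjoint (disjoint_sdiff_sdiff)]
  congr 1
  ext t
  simp only [onesSet, Finset.mem_filter, Finset.mem_univ, true_and, Finset.mem_union,
    Finset.mem_sdiff]
  generalize u t = a
  generalize v t = b
  revert a b
  decide

theorem hammingDist_eq_two_mul {n : ℕ} {u v : Fin n → ZMod 2} (h : wtOnes u = wtOnes v) :
    hammingDist u v = 2 * (onesSet u \ onesSet v).card := by
  rw [hammingDist_eq_card_sdiff_add, Finset.card_sdiff_comm (s := onesSet v) (t := onesSet u) h.symm]
  ring

theorem pairSum_univ_eq {n w k : ℕ} {u v : Fin n → ZMod 2} (hwn : 2 * w ≤ n) (hkw : k ≤ w)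
    (hu : wtOnes u = w) (hv : wtOnes v = w) :
    pairSum k Finset.univ (onesSet u) (onesSet v) =
      2 ^ k * (johnsonQ n w k (onesSet u \ onesSet v).card *
        (w.descFactorial k * (n - w).descFactorial k)) := by
  have hu' : (onesSet u).card = w := hu
  have hv' : (onesSet v).card = w := hv
  have hS := Finset.card_sdiff_add_card_inter (onesSet u) (onesSet v)
  have hT := Finset.card_sdiff_add_card_inter (onesSet v) (onesSet u)
  have hU := Finset.card_union_add_card_inter (onesSet u) (onesSet v)
  have hc := Finset.card_compl (onesSet u ∪ onesSet v)
  rw [Finset.inter_comm] at hT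
  rw [Fintype.card_fin] at hc
  rw [johnsonQ_mul_eq_pairKernel hwn hkw (by omega), pairSum_eq]
  congr 2
  · rw [show (Finset.univ.filter fun x => x ∈ onesSet u ∧ x ∈ onesSet v) =
      onesSet u ∩ onesSet v by ext; simp]
    omega
  · rw [show (Finset.univ.filter fun x => x ∉ onesSet u ∧ x ∉ onesSet v) =
      (onesSet u ∪ onesSet v)ᶜ by ext; simp]
    omega
  · congr 1
    ext
    simp
  · rw [show (Finset.univ.filter fun x => x ∉ onesSet u ∧ x ∈ onesSet v) =
      onesSet v \ onesSet u by ext; simp [and_comm]]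
    omega

theorem sum_johnsonQ_nonneg {n w k : ℕ} {C : Finset (Fin n → ZMod 2)} (hwn : 2 * w ≤ n)
    (hkw : k ≤ w) (hC : ∀ c ∈ C, wtOnes c = w) :
    0 ≤ ∑ c ∈ C, ∑ u ∈ C, johnsonQ n w k (onesSet u \ onesSet c).card := by
  have hpos : (0 : ℚ) < 2 ^ k * (w.descFactorial k * (n - w).descFactorial k) := by
    have h1 : 0 < w.descFactorial k := Nat.descFactorial_pos.mpr hkw
    have h2 : 0 < (n - w).descFactorial k := Nat.descFactorial_pos.mpr (by omega)
    positivity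
  refine nonneg_of_mul_nonneg_left ?_ hpos
  refine (pairSum_posSemidef onesSet C k Finset.univ (fun _ => 1)).trans_eq (Eq.symm ?_)
  rw [Finset.sum_comm, Finset.sum_mul]
  refine Finset.sum_congr rfl fun u hu => ?_
  rw [Finset.sum_mul]
  refine Finset.sum_congr rfl fun v hv => ?_
  rw [pairSum_univ_eq hwn hkw (hC u hu) (hC v hv)]
  ring

/-- Delsarte: If `{A_{2i}}` is the distance distribution of a nonempty
`(n,d,w)` constant-weight code with `d` even and `d < 2w ≤ n`, then for every
`k = 1, …, w`, `∑_{i=d/2}^{w} q(k,i,n,w) A_{2i} ≥ -1`. -/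
theorem delsarte_cw (n d w : ℕ) (C : Finset (Fin n → ZMod 2)) (hC : C.Nonempty)
    (hcode : IsCWCode n d w C) (hd : Even d) (hdw : d < 2 * w) (hwn : 2 * w ≤ n) :
    ∀ k : ℕ, 1 ≤ k → k ≤ w →
      (-1 : ℚ) ≤ ∑ i ∈ Finset.Icc (d / 2) w,
        ((∑ j ∈ Finset.range (i + 1),
            (-1 : ℚ) ^ j * (k.choose j) * ((w - k).choose (i - j)) *
              ((n - w - k).choose (i - j))) /
          ((w.choose i : ℚ) * ((n - w).choose i : ℚ))) * distDistr C (2 * i) := by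
  intro k _ hkw
  change (-1 : ℚ) ≤ ∑ i ∈ Finset.Icc (d / 2) w, johnsonQ n w k i * distDistr C (2 * i)
  have hcard : (0 : ℚ) < C.card := by exact_mod_cast hC.card_pos
  have expand : ∑ i ∈ Finset.Icc (d / 2) w, johnsonQ n w k i * distDistr C (2 * i) =
      (∑ c ∈ C, ∑ u ∈ C, ∑ i ∈ Finset.Icc (d / 2) w,
        if hammingDist u c = 2 * i then johnsonQ n w k i else 0) / C.card := by
    simp only [distDistr, Sdist, Finset.card_filter, mul_div_assoc', ← Finset.sum_div]
    congr 1
    push_cast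
    simp only [Finset.mul_sum, mul_ite, mul_one, mul_zero]
    rw [Finset.sum_comm]
    exact Finset.sum_congr rfl fun c _ => Finset.sum_comm
  have pointwise : ∀ c ∈ C, ∀ u ∈ C,
      johnsonQ n w k (onesSet u \ onesSet c).card - (if u = c then 1 else 0) ≤
        ∑ i ∈ Finset.Icc (d / 2) w, if hammingDist u c = 2 * i then johnsonQ n w k i else 0 := by
    intro c hc u hu
    have hdist := hammingDist_eq_two_mul ((hcode.1 u hu).trans (hcode.1 c hc).symm)
    have hle : (onesSet u \ onesSet c).card ≤ w :=
      (Finset.card_le_card Finset.sdiff_subset).trans_eq (hcode.1 u hu)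
    simp only [hdist, mul_right_inj' (two_ne_zero : (2 : ℕ) ≠ 0), Finset.sum_ite_eq,
      Finset.mem_Icc]
    by_cases huc : u = c
    · subst huc
      simp only [sdiff_self, Finset.bot_eq_empty, Finset.card_empty, johnsonQ_zero, if_true, sub_self]
      split_ifs <;> norm_num
    · have := hcode.2 u hu c hc huc
      rw [if_neg huc, if_pos ⟨by omega, hle⟩, sub_zero]
  have total := Finset.sum_le_sum fun c hc => Finset.sum_le_sum (pointwise c hc)
  have nonneg := sum_johnsonQ_nonneg hwn hkw hcode.1
  have diag : ∑ c ∈ C, ∑ u ∈ C, (if u = c then (1 : ℚ) else 0) = C.card := by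
    rw [Finset.sum_congr rfl fun c hc => by rw [Finset.sum_ite_eq' C c, if_pos hc]]
    simp
  simp only [Finset.sum_sub_distrib, diag] at total
  rw [expand, le_div_iff₀ hcard]
  linarith
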